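/- arXiv:1904.10751 — 4 statements merged into one kernel-verified Lean document; each statement's English description precedes it below -/
import Mathlib

section
/- Let a < b be real numbers and Y₁, Y₂, Y₃, Y₄ ∈ ℝ. Let u and v be real polynomials (regarded as functions on ℝ) satisfying the boundary conditions u(a) − Y₁ u'(a) − Y₂ u''(a) = 0, u(b) − Y₃ u''(b) = 0, u'(b) − Y₄ u''(b) = 0, and v(b) − Y₄ v'(b) + Y₃ v''(b) = 0, v(a) + Y₂ v''(a) = 0, v'(a) − Y₁ v''(a) = 0. Then ∫_a^b u'''(x) v(x) dx = −∫_a^b u(x) v'''(x) dx. -/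
open Polynomial

/-- Integration by parts without boundary terms for polynomials satisfying the
transparent boundary conditions and their dual conditions. -/
theorem stmt3 (a b : ℝ) (hab : a < b) (Y₁ Y₂ Y₃ Y₄ : ℝ) (u v : Polynomial ℝ)
    (hu_a : u.eval a - Y₁ * (derivative u).eval a - Y₂ * (derivative (derivative u)).eval a = 0)
    (hu_b : u.eval b - Y₃ * (derivative (derivative u)).eval b = 0)
    (hu_b' : (derivative u).eval b - Y₄ * (derivative (derivative u)).eval b = 0)
    (hv_b : v.eval b - Y₄ * (derivative v).eval b + Y₃ * (derivative (derivative v)).eval b = 0)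
    (hv_a : v.eval a + Y₂ * (derivative (derivative v)).eval a = 0)
    (hv_a' : (derivative v).eval a - Y₁ * (derivative (derivative v)).eval a = 0) :
    ∫ x in a..b, (derivative (derivative (derivative u))).eval x * v.eval x =
      -∫ x in a..b, u.eval x * (derivative (derivative (derivative v))).eval x := by
  have hF (p : ℝ[X]) : ∫ x in a..b, (derivative p).eval x = p.eval b - p.eval a :=
    intervalIntegral.integral_eq_sub_of_hasDerivAt (fun x _ => p.hasDerivAt x)
      ((derivative p).continuous.intervalIntegrable a b)
  have h := hF (derivative (derivative u) * v - derivative u * derivative v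
    + u * derivative (derivative v))
  rw [eq_neg_iff_add_eq_zero, ← intervalIntegral.integral_add
    (by apply Continuous.intervalIntegrable; fun_prop)
    (by apply Continuous.intervalIntegrable; fun_prop)]
  calc
    _ = _ := by
      refine intervalIntegral.integral_congr fun x _ => ?_
      simp only [derivative_add, derivative_sub, derivative_mul, eval_add, eval_sub, eval_mul]
      ring
    _ = _ := h
    _ = 0 := by
      simp only [eval_add, eval_sub, eval_mul]
      linear_combination (derivative (derivative u)).eval b * hv_b
        - (derivative v).eval b * hu_b' + (derivative (derivative v)).eval b * hu_b
        - (derivative (derivative u)).eval a * hv_a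
        + (derivative u).eval a * hv_a' - (derivative (derivative v)).eval a * hu_a
end

section
/- For every natural number n, the derivative of the n-th Legendre polynomial satisfies the expansion L_n'(x) = Σ_{k=0}^{n−1} (2k+1) L_k(x), where the sum runs over those k with 0 ≤ k ≤ n−1 for which k + n is odd. This is an identity of polynomials. -/
open Polynomial

/-- The `n`-th Legendre polynomial on `[−1, 1]`, via the Rodrigues formula
`L_n(x) = (1/(2ⁿ n!)) (d/dx)ⁿ (x² − 1)ⁿ`. -/
noncomputable def legendre (n : ℕ) : Polynomial ℝ :=
  C (1 / (2 ^ n * n.factorial : ℝ)) * derivative^[n] ((X ^ 2 - 1) ^ n)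

theorem derivative_derivative_X_sq_sub_one_pow (n : ℕ) :
    derivative (derivative ((X ^ 2 - 1 : ℝ[X]) ^ (n + 2))) =
      C (2 * (n + 2) * (2 * n + 3) : ℝ) * (X ^ 2 - 1) ^ (n + 1) +
        C (4 * (n + 1) * (n + 2) : ℝ) * (X ^ 2 - 1) ^ n := by
  simp only [derivative_pow, derivative_mul, derivative_sub, derivative_X, derivative_one,
    derivative_natCast, derivative_ofNat, derivative_zero, map_mul, map_add, map_natCast, map_ofNat, map_one,
    Nat.add_sub_cancel, Nat.add_succ_sub_one, Nat.cast_add, Nat.cast_one, Nat.cast_ofNat]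
  ring

theorem derivative_legendre_add_two (n : ℕ) :
    derivative (legendre (n + 2)) =
      derivative (legendre n) + C (2 * ((n + 1 : ℕ) : ℝ) + 1) * legendre (n + 1) := by
  have h : derivative (derivative^[n + 2] ((X ^ 2 - 1 : ℝ[X]) ^ (n + 2))) =
      C (2 * (n + 2) * (2 * n + 3) : ℝ) * derivative^[n + 1] ((X ^ 2 - 1) ^ (n + 1)) +
        C (4 * (n + 1) * (n + 2) : ℝ) * derivative (derivative^[n] ((X ^ 2 - 1) ^ n)) := by
    rw [← Function.iterate_succ_apply' derivative, ← Function.iterate_succ_apply' derivative,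
      Function.iterate_succ_apply, Function.iterate_succ_apply,
      derivative_derivative_X_sq_sub_one_pow, iterate_map_add,
      iterate_derivative_C_mul, iterate_derivative_C_mul]
  simp only [legendre, derivative_C_mul, h, mul_add, ← mul_assoc, ← C_mul]
  rw [add_comm]
  congr 3 <;> push_cast [Nat.factorial_succ] <;> field_simp <;> ring

/-- `L_n'(x) = Σ_{k < n, k+n odd} (2k+1) L_k(x)` as an identity of polynomials. -/
theorem stmt8 (n : ℕ) :
    derivative (legendre n) =
      ∑ k ∈ (Finset.range n).filter (fun k => Odd (k + n)),
        C ((2 * (k : ℝ) + 1)) * legendre k := by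
  induction n using Nat.twoStepInduction with
  | zero => simp [legendre]
  | one =>
    have h : C (2⁻¹ : ℝ) * C 2 = 1 := by
      rw [← C_mul, inv_mul_cancel₀ two_ne_zero, C_1]
    simpa [legendre, Finset.sum_filter, one_add_one_eq_two] using h
  | more n ih _ =>
    have hodd : ∀ k, Odd (k + (n + 2)) ↔ Odd (k + n) := fun k => by grind
    have h₁ : Odd (n + 1 + n) := by grind
    have h₂ : ¬ Odd (n + n) := by grind
    simp only [Finset.sum_filter, hodd] at ih ⊢
    rw [Finset.sum_range_succ, Finset.sum_range_succ, if_pos h₁, if_neg h₂, add_zero, ← ih,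
      derivative_legendre_add_two]
end

section
/- Let i, j be natural numbers with i ≠ j, let Y₁, Y₂, Y₃, Y₄ ∈ ℝ, and let α_i, β_i, γ_i, α_j, β_j, γ_j ∈ ℝ. Define φ_i = L_i + α_i L_{i+1} + β_i L_{i+2} + γ_i L_{i+3} and ψ_j = L_j − α_j L_{j+1} + β_j L_{j+2} − γ_j L_{j+3}. Assume φ_i satisfies φ_i(−1) − Y₁ φ_i'(−1) − Y₂ φ_i''(−1) = 0, φ_i(1) − Y₃ φ_i''(1) = 0, φ_i'(1) − Y₄ φ_i''(1) = 0, and ψ_j satisfies ψ_j(1) − Y₄ ψ_j'(1) + Y₃ ψ_j''(1) = 0, ψ_j(−1) + Y₂ ψ_j''(−1) = 0, ψ_j'(−1) − Y₁ ψ_j''(−1) = 0. Then ∫_{−1}^{1} φ_i'''(x) ψ_j(x) dx = 0. -/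
open Polynomial

/-- Integration by parts for polynomials on `[-1, 1]`. -/
theorem integral_derivative_mul (p q : ℝ[X]) :
    ∫ x in (-1 : ℝ)..1, (derivative p).eval x * q.eval x =
      p.eval 1 * q.eval 1 - p.eval (-1) * q.eval (-1) -
        ∫ x in (-1 : ℝ)..1, p.eval x * (derivative q).eval x := by
  rw [intervalIntegral.integral_mul_deriv_eq_deriv_mul (u := fun x => p.eval x)
    (v := fun x => q.eval x) (fun x _ => p.hasDerivAt x) (fun x _ => q.hasDerivAt x)
    ((derivative p).continuous.intervalIntegrable _ _)
    ((derivative q).continuous.intervalIntegrable _ _)]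
  ring

theorem eval_iterate_derivative_sq_sub_one_pow {m n : ℕ} (h : m < n) {x : ℝ} (hx : x ^ 2 = 1) :
    (derivative^[m] ((X ^ 2 - 1 : ℝ[X]) ^ n)).eval x = 0 := by
  obtain ⟨r, hr⟩ := pow_sub_dvd_iterate_derivative_pow (X ^ 2 - 1 : ℝ[X]) n m
  rw [hr]
  simp [hx, Nat.sub_ne_zero_of_lt h]

theorem integral_iterate_derivative_sq_sub_one_pow_mul {n m : ℕ} (h : m ≤ n) (q : ℝ[X])
    (hq : derivative^[m] q = 0) :
    ∫ x in (-1 : ℝ)..1, (derivative^[m] ((X ^ 2 - 1 : ℝ[X]) ^ n)).eval x * q.eval x = 0 := by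
  induction m generalizing q with
  | zero => simp_all
  | succ m ih =>
    rw [Function.iterate_succ_apply', integral_derivative_mul, ih (by omega) _ hq,
      eval_iterate_derivative_sq_sub_one_pow h (by norm_num),
      eval_iterate_derivative_sq_sub_one_pow h (by norm_num)]
    simp

/-- `legendre n` is orthogonal to polynomials of degree less than `n`. -/
theorem integral_legendre_mul (n : ℕ) (q : ℝ[X]) (hq : derivative^[n] q = 0) :
    ∫ x in (-1 : ℝ)..1, (legendre n).eval x * q.eval x = 0 := by
  simp only [legendre, eval_mul, eval_C, mul_assoc]
  rw [intervalIntegral.integral_const_mul,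
    integral_iterate_derivative_sq_sub_one_pow_mul le_rfl q hq, mul_zero]

theorem iterate_derivative_eq_zero_of_le {m n : ℕ} (h : m ≤ n) {q : ℝ[X]}
    (hq : derivative^[m] q = 0) : derivative^[n] q = 0 := by
  obtain ⟨k, rfl⟩ := Nat.exists_eq_add_of_le' h
  rw [Function.iterate_add_apply, hq, iterate_derivative_zero]

theorem iterate_derivative_legendre {n k : ℕ} (h : n < k) :
    derivative^[k] (legendre n) = 0 := by
  rw [legendre, iterate_derivative_C_mul, ← Function.iterate_add_apply,
    iterate_derivative_eq_zero, mul_zero]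
  have : ((X ^ 2 - 1 : ℝ[X]) ^ n).natDegree ≤ n * 2 :=
    natDegree_pow_le_of_le n (by compute_degree)
  omega

theorem integral_legendre_combination_mul (n : ℕ) (a b c : ℝ) (q : ℝ[X])
    (hq : derivative^[n] q = 0) :
    ∫ x in (-1 : ℝ)..1, (legendre n + C a * legendre (n + 1) + C b * legendre (n + 2) +
      C c * legendre (n + 3)).eval x * q.eval x = 0 := by
  have h (k : ℕ) := integral_legendre_mul (n + k) q
    (iterate_derivative_eq_zero_of_le (Nat.le_add_right n k) hq)
  have hi (k : ℕ) : IntervalIntegrable (fun x => (legendre k).eval x * q.eval x)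
      MeasureTheory.volume (-1) 1 :=
    (by fun_prop : Continuous _).intervalIntegrable _ _
  simp only [eval_add, eval_mul, eval_C, add_mul, mul_assoc]
  rw [intervalIntegral.integral_add
      (((hi _).add ((hi _).const_mul _)).add ((hi _).const_mul _)) ((hi _).const_mul _),
    intervalIntegral.integral_add ((hi _).add ((hi _).const_mul _)) ((hi _).const_mul _),
    intervalIntegral.integral_add (hi _) ((hi _).const_mul _)]
  simp only [intervalIntegral.integral_const_mul, h, integral_legendre_mul n q hq]
  ring

theorem iterate_derivative_legendre_combination {n k : ℕ} (h : n < k) (a b c : ℝ) :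
    derivative^[k] (derivative (derivative (derivative (legendre n + C a * legendre (n + 1) +
      C b * legendre (n + 2) + C c * legendre (n + 3))))) = 0 := by
  change derivative^[k + 3] _ = 0
  simp only [iterate_map_add, iterate_derivative_C_mul]
  rw [iterate_derivative_legendre (by omega), iterate_derivative_legendre (by omega),
    iterate_derivative_legendre (by omega), iterate_derivative_legendre (by omega)]
  simp

/-- For `i ≠ j`, if `φ_i` satisfies the transparent boundary conditions defining `V_N`
and `ψ_j` satisfies the dual boundary conditions defining `V_N*`, then
`∫_{−1}^{1} φ_i'''(x) ψ_j(x) dx = 0`. -/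
theorem stmt13 (i j : ℕ) (hij : i ≠ j) (Y₁ Y₂ Y₃ Y₄ : ℝ) (αi βi γi αj βj γj : ℝ)
    (φ ψ : Polynomial ℝ)
    (hφ : φ = legendre i + C αi * legendre (i + 1) + C βi * legendre (i + 2) +
      C γi * legendre (i + 3))
    (hψ : ψ = legendre j - C αj * legendre (j + 1) + C βj * legendre (j + 2) -
      C γj * legendre (j + 3))
    (hφa : φ.eval (-1) - Y₁ * (derivative φ).eval (-1) -
      Y₂ * (derivative (derivative φ)).eval (-1) = 0)
    (hφb : φ.eval 1 - Y₃ * (derivative (derivative φ)).eval 1 = 0)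
    (hφb' : (derivative φ).eval 1 - Y₄ * (derivative (derivative φ)).eval 1 = 0)
    (hψb : ψ.eval 1 - Y₄ * (derivative ψ).eval 1 +
      Y₃ * (derivative (derivative ψ)).eval 1 = 0)
    (hψa : ψ.eval (-1) + Y₂ * (derivative (derivative ψ)).eval (-1) = 0)
    (hψa' : (derivative ψ).eval (-1) - Y₁ * (derivative (derivative ψ)).eval (-1) = 0) :
    ∫ x in (-1 : ℝ)..1,
        (derivative (derivative (derivative φ))).eval x * ψ.eval x = 0 := by
  have hψ' : ψ = legendre j + C (-αj) * legendre (j + 1) + C βj * legendre (j + 2) +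
      C (-γj) * legendre (j + 3) := by
    rw [hψ, C_neg, C_neg]
    ring
  rcases hij.lt_or_gt with h | h
  · have key := integral_legendre_combination_mul j (-αj) βj (-γj) _
      (iterate_derivative_legendre_combination h αi βi γi)
    rw [← hψ', ← hφ] at key
    simpa only [mul_comm] using key
  · have key := integral_legendre_combination_mul i αi βi γi _
      (iterate_derivative_legendre_combination h (-αj) βj (-γj))
    rw [← hψ', ← hφ] at key
    rw [integral_derivative_mul, integral_derivative_mul, integral_derivative_mul, key]
    linear_combination (derivative (derivative φ)).eval 1 * hψb
      + (derivative (derivative ψ)).eval 1 * hφb - (derivative ψ).eval 1 * hφb'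
      - (derivative (derivative φ)).eval (-1) * hψa + (derivative φ).eval (-1) * hψa'
      - (derivative (derivative ψ)).eval (-1) * hφa
end

section
/- For every g ∈ ℝ there exists a constant c > 0, depending only on g, such that for all τ ∈ (0, 1] and all k ∈ ℤ, 1 + τ² g² k² ≤ (1 + cτ)(1 + τ² k⁶); equivalently, the squared amplification factor (1 + τ²g²k²)/(1 + τ²k⁶) of the Fourier symbol of the splitting scheme is bounded by 1 + cτ. -/
theorem mul_le_cube_add_const {a x : ℝ} (ha : 0 ≤ a) (hx : 0 ≤ x) :
    a * x ≤ x ^ 3 + (a ^ 2 + a + 1) := by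
  rcases le_total x 1 with h | h
  · nlinarith [mul_le_mul_of_nonneg_left h ha, pow_nonneg hx 3, sq_nonneg a]
  · nlinarith [mul_le_mul_of_nonneg_left h (sq_nonneg x), sq_nonneg (a - x), sq_nonneg (a + x)]

/-- For every `g` there is `c > 0` (depending only on `g`) such that the squared
amplification factor satisfies `1 + τ²g²k² ≤ (1 + cτ)(1 + τ²k⁶)` for all
`τ ∈ (0, 1]` and all integers `k`. -/
theorem stmt16 (g : ℝ) :
    ∃ c : ℝ, 0 < c ∧ ∀ τ : ℝ, 0 < τ → τ ≤ 1 → ∀ k : ℤ,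
      1 + τ ^ 2 * g ^ 2 * (k : ℝ) ^ 2 ≤ (1 + c * τ) * (1 + τ ^ 2 * (k : ℝ) ^ 6) := by
  refine ⟨(g ^ 2) ^ 2 + g ^ 2 + 1, by positivity, fun τ h0 h1 k => ?_⟩
  have hk := mul_le_cube_add_const (sq_nonneg g) (sq_nonneg (k : ℝ))
  set c := (g ^ 2) ^ 2 + g ^ 2 + 1 with hc
  have hc0 : 0 ≤ c := by positivity
  have hτ : τ ^ 2 ≤ τ := by nlinarith
  calc 1 + τ ^ 2 * g ^ 2 * (k : ℝ) ^ 2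
      = 1 + τ ^ 2 * (g ^ 2 * (k : ℝ) ^ 2) := by ring
    _ ≤ 1 + τ ^ 2 * (((k : ℝ) ^ 2) ^ 3 + c) := by gcongr
    _ = 1 + τ ^ 2 * (k : ℝ) ^ 6 + c * τ ^ 2 := by ring
    _ ≤ 1 + τ ^ 2 * (k : ℝ) ^ 6 + c * τ := by gcongr
    _ ≤ 1 + τ ^ 2 * (k : ℝ) ^ 6 + c * τ + c * τ * (τ ^ 2 * (k : ℝ) ^ 6) :=
        le_add_of_nonneg_right (by positivity)
    _ = (1 + c * τ) * (1 + τ ^ 2 * (k : ℝ) ^ 6) := by ring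
end
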